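/- Let X = l_∞(ℤ, ℂ^k), let V ⊆ X be open, let 𝓔 ⊆ ℂ^s be open with e† ∈ 𝓔, and let G : V × 𝓔 → X be continuously Fréchet differentiable in its first variable. Let Σ ⊆ V be uniformly discrete, with G(v†, e†) = 0 for every v† ∈ Σ. Assume: (1) for every v† ∈ Σ the operator D_vG(v†, e†) : X → X is invertible with bounded inverse, and sup_{v†∈Σ} ‖D_vG(v†, e†)⁻¹‖ < ∞; (2) for every γ > 0 there exist λ₀ > 0 and δ₀ > 0 such that for all v† ∈ Σ, all v with ‖v − v†‖_∞ < λ₀ and all e with |e − e†| < δ₀, one has ‖G(v, e)‖_∞ < γ and ‖D_vG(v, e) − D_vG(v†, e†)‖ < γ. Then there exist δ₁ > 0 and λ₁ > 0 such that: for every e with |e − e†| < δ₁ and every v† ∈ Σ there is a unique point θ(e; v†) in the closed ball of radius λ₁ about v† with G(θ(e; v†), e) = 0; moreover the closed balls of radius λ₁ about the points of Σ are pairwise disjoint, so for each such e the map v† ↦ θ(e; v†) is injective on Σ. -/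

import Mathlib

noncomputable section
open Set Metric Topology Filter ENNReal

/-- `X = l_∞(ℤ, ℂ^k)`: bounded bi-infinite `ℂ^k`-valued sequences with the sup norm. -/
abbrev XSp (k : ℕ) := lp (fun _ : ℤ => EuclideanSpace ℂ (Fin k)) ∞

/-- The shift operator `σ` on `l_∞(ℤ, ℂ^k)`. -/
def shiftL {k : ℕ} (ξ : XSp k) : XSp k :=
  ⟨fun i => ξ (i + 1), by
    apply memℓp_infty
    have h := memℓp_infty_iff.1 (lp.memℓp ξ)
    obtain ⟨R, hR⟩ := h
    exact ⟨R, by rintro x ⟨i, rfl⟩; exact hR ⟨i + 1, rfl⟩⟩⟩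

/-- Mean value inequality on a ball: if the derivative of `f` stays within `C` of `T`, then `f - T`
is `C`-Lipschitz there. -/
theorem norm_image_sub_sub_le_of_mem_closedBall {𝕜 E F : Type*} [RCLike 𝕜]
    [NormedAddCommGroup E] [NormedSpace 𝕜 E] [NormedAddCommGroup F] [NormedSpace 𝕜 F]
    {f : E → F} {f' : E → E →L[𝕜] F} {T : E →L[𝕜] F} {x : E} {r C : ℝ}
    (hf : ∀ w ∈ closedBall x r, HasFDerivAt f (f' w) w)
    (hC : ∀ w ∈ closedBall x r, ‖f' w - T‖ ≤ C) :
    ∀ u ∈ closedBall x r, ∀ v ∈ closedBall x r, ‖f u - f v - T (u - v)‖ ≤ C * ‖u - v‖ := by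
  intro u hu v hv
  let _ : NormedSpace ℝ E := NormedSpace.restrictScalars ℝ 𝕜 E
  exact (convex_closedBall x r).norm_image_sub_le_of_norm_hasFDerivWithin_le'
    (fun w hw => (hf w hw).hasFDerivWithinAt) hC hv hu

/-- Newton's method with a frozen derivative: a map on a closed ball of a Banach space which is
close to an invertible linear map `T`, and small at the centre, has exactly one zero in the ball. -/
theorem existsUnique_zero_mem_closedBall {𝕜 E F : Type*} [NontriviallyNormedField 𝕜]
    [NormedAddCommGroup E] [NormedSpace 𝕜 E] [CompleteSpace E]
    [NormedAddCommGroup F] [NormedSpace 𝕜 F]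
    (f : E → F) (T : E ≃L[𝕜] F) {x : E} {r M : ℝ} (hr : 0 ≤ r) (hM : 0 < M)
    (hT : ‖(T.symm : F →L[𝕜] E)‖ ≤ M)
    (hlin : ∀ u ∈ closedBall x r, ∀ v ∈ closedBall x r,
      ‖f u - f v - T (u - v)‖ ≤ 1 / (2 * M) * ‖u - v‖)
    (hx : ‖f x‖ ≤ r / (2 * M)) :
    ∃! v : E, v ∈ closedBall x r ∧ f v = 0 := by
  have hTle (y : F) : ‖T.symm y‖ ≤ M * ‖y‖ :=
    (T.symm : F →L[𝕜] E).le_of_opNorm_le hT y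
  set N : E → E := fun v => v - T.symm (f v) with hN
  have hNsub : ∀ u ∈ closedBall x r, ∀ v ∈ closedBall x r, ‖N u - N v‖ ≤ 1 / 2 * ‖u - v‖ := by
    intro u hu v hv
    have h : N u - N v = -T.symm (f u - f v - T (u - v)) := by
      simp only [hN, map_sub, ContinuousLinearEquiv.symm_apply_apply]
      abel
    rw [h, norm_neg]
    calc _ ≤ M * ‖f u - f v - T (u - v)‖ := hTle _
      _ ≤ M * (1 / (2 * M) * ‖u - v‖) := by gcongr; exact hlin u hu v hv
      _ = 1 / 2 * ‖u - v‖ := by field_simp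
  have hxmem : x ∈ closedBall x r := mem_closedBall_self hr
  have hmaps : MapsTo N (closedBall x r) (closedBall x r) := by
    intro v hv
    have h1 := hNsub v hv x hxmem
    have h2 : ‖N x - x‖ ≤ r / 2 := by
      have h : N x - x = -T.symm (f x) := by simp [hN]
      rw [h, norm_neg]
      calc _ ≤ M * ‖f x‖ := hTle _
        _ ≤ M * (r / (2 * M)) := by gcongr
        _ = r / 2 := by field_simp
    rw [mem_closedBall, dist_eq_norm] at hv ⊢
    have h3 := norm_sub_le_norm_sub_add_norm_sub (N v) (N x) x
    linarith
  have hcontr : ContractingWith (1 / 2) (hmaps.restrict N _ _) := by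
    refine ⟨by rw [one_div]; exact NNReal.inv_lt_one_iff (by norm_num) |>.2 (by norm_num), ?_⟩
    refine LipschitzWith.of_dist_le_mul fun u v => ?_
    simpa [Subtype.dist_eq, dist_eq_norm] using hNsub u u.2 v v.2
  obtain ⟨v, hv, hfix, -⟩ :=
    hcontr.exists_fixedPoint' isClosed_closedBall.isComplete hmaps hxmem (edist_ne_top _ _)
  refine ⟨v, ⟨hv, ?_⟩, ?_⟩
  · simpa [hN, Function.IsFixedPt] using hfix
  · rintro w ⟨hw, hw0⟩
    have hNw : N w = w := by simp [hN, hw0]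
    have h := hNsub w hw v hv
    rw [hNw, hfix.eq] at h
    have h0 := norm_nonneg (w - v)
    exact sub_eq_zero.1 (norm_eq_zero.1 (by linarith))

/-- Uniform implicit function theorem on `l_∞(ℤ, ℂ^k)`: given `G : V × 𝓔 → X`
vanishing at `(v†, e†)` for every `v†` in a uniformly discrete set `Σ`, with the
partial derivatives `D_vG(v†, e†)` invertible with uniformly bounded inverses, and
with `G` and `D_vG` uniformly small perturbations near `Σ × {e†}`, there are
`δ₁, λ₁ > 0` such that for `|e − e†| < δ₁` each `v† ∈ Σ` has a unique zero
`θ(e; v†)` of `G(·, e)` in the closed `λ₁`-ball about `v†`; the closed `λ₁`-balls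
about points of `Σ` are pairwise disjoint, so `v† ↦ θ(e; v†)` is injective. -/
theorem uniform_implicit_function_theorem (k s : ℕ)
    (V : Set (XSp k)) (hV : IsOpen V)
    (Edom : Set (EuclideanSpace ℂ (Fin s))) (hE : IsOpen Edom)
    (edag : EuclideanSpace ℂ (Fin s)) (hedag : edag ∈ Edom)
    (G : XSp k → EuclideanSpace ℂ (Fin s) → XSp k)
    (DG : XSp k → EuclideanSpace ℂ (Fin s) → (XSp k →L[ℂ] XSp k))
    (hderiv : ∀ e ∈ Edom, ∀ v ∈ V, HasFDerivAt (fun u => G u e) (DG v e) v)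
    (hcont : ∀ e ∈ Edom, ContinuousOn (fun v => DG v e) V)
    (Sig : Set (XSp k)) (hSigV : Sig ⊆ V)
    (τ : ℝ) (hτ : 0 < τ)
    (hdisc : ∀ u ∈ Sig, ∀ v ∈ Sig, u ≠ v → τ < ‖u - v‖)
    (hzero : ∀ v ∈ Sig, G v edag = 0)
    (M : ℝ)
    (hinv : ∀ v ∈ Sig, ∃ T : XSp k ≃L[ℂ] XSp k,
      (T : XSp k →L[ℂ] XSp k) = DG v edag ∧
      ‖(T.symm : XSp k →L[ℂ] XSp k)‖ ≤ M)
    (happrox : ∀ γ > (0 : ℝ), ∃ lam₀ > (0 : ℝ), ∃ δ₀ > (0 : ℝ), ∀ vd ∈ Sig,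
      Metric.ball vd lam₀ ⊆ V ∧
      ∀ v ∈ Metric.ball vd lam₀, ∀ e ∈ Edom, dist e edag < δ₀ →
        ‖G v e‖ < γ ∧ ‖DG v e - DG vd edag‖ < γ) :
    ∃ δ₁ > (0 : ℝ), ∃ lam₁ > (0 : ℝ),
      (∀ u ∈ Sig, ∀ v ∈ Sig, u ≠ v →
        Disjoint (Metric.closedBall u lam₁) (Metric.closedBall v lam₁)) ∧
      ∀ e ∈ Edom, dist e edag < δ₁ → ∀ vd ∈ Sig,
        ∃! v : XSp k, v ∈ Metric.closedBall vd lam₁ ∧ G v e = 0 := by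
  obtain ⟨K, hK, hMK⟩ : ∃ K : ℝ, 0 < K ∧ M ≤ K :=
    ⟨max M 1, lt_max_of_lt_right one_pos, le_max_left _ _⟩
  obtain ⟨lam, hlam, δ, hδ, hder⟩ := happrox (1 / (2 * K)) (by positivity)
  obtain ⟨r, hr, hrlam, hrτ⟩ : ∃ r : ℝ, 0 < r ∧ r < lam ∧ 2 * r ≤ τ :=
    ⟨min (lam / 2) (τ / 2), by positivity, by linarith [min_le_left (lam / 2) (τ / 2)],
      by linarith [min_le_right (lam / 2) (τ / 2)]⟩
  obtain ⟨lam', hlam', δ', hδ', hval⟩ := happrox (r / (2 * K)) (by positivity)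
  refine ⟨min δ δ', lt_min hδ hδ', r, hr, ?_, ?_⟩
  · intro u hu v hv huv
    rw [Set.disjoint_left]
    intro w hwu hwv
    have h := hdisc u hu v hv huv
    rw [mem_closedBall] at hwu hwv
    have h' := dist_triangle_left u v w
    rw [dist_eq_norm u v] at h'
    linarith
  · intro e he hed vd hvd
    obtain ⟨T, hT, hTM⟩ := hinv vd hvd
    obtain ⟨hball, hnear⟩ := hder vd hvd
    have hsub : closedBall vd r ⊆ ball vd lam := closedBall_subset_ball hrlam
    refine existsUnique_zero_mem_closedBall (fun v => G v e) T hr.le hK (hTM.trans hMK) ?_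
      ((hval vd hvd).2 vd (mem_ball_self hlam') e he (hed.trans_le (min_le_right _ _))).1.le
    refine norm_image_sub_sub_le_of_mem_closedBall
      (fun w hw => hderiv e he w (hball (hsub hw))) (T := (T : XSp k →L[ℂ] XSp k)) fun w hw => ?_
    rw [hT]
    exact (hnear w (hsub hw) e he (hed.trans_le (min_le_left _ _))).2.le
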